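/- Let G be a countable group satisfying the Tits alternative in the following sense: every finitely generated subgroup H of G either contains a free group on two generators (there is an injective group homomorphism from FreeGroup (Fin 2) into H) or is virtually solvable. Then every group shift on G is of finite type (for every finite group Σ, every subset X ⊆ (G → Σ) that is closed in the product topology, shift-invariant, and a subgroup under pointwise operations is of finite type) if and only if G is virtually polycyclic. -/

import Mathlib

/-- The product topology on `G → A` where the alphabet `A` carries the discrete topology. -/
def prodTop (G A : Type*) : TopologicalSpace (G → A) :=
  @Pi.topologicalSpace G (fun _ => A) (fun _ => ⊥)

/-- The shift action of a group `G` on `G → A`: `(g • x) h = x (g⁻¹ * h)`. -/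
def shift {G : Type*} [Group G] {A : Type*} (g : G) (x : G → A) : G → A :=
  fun h => x (g⁻¹ * h)

/-- A subshift `X ⊆ A^G` is of finite type if there is a clopen set `C` such that
`x ∈ X` iff all shifts of `x` lie in `C`. -/
def IsSFT {G : Type*} [Group G] (A : Type*) (X : Set (G → A)) : Prop :=
  ∃ C : Set (G → A), @IsClopen _ (prodTop G A) C ∧ ∀ x, x ∈ X ↔ ∀ g : G, shift g x ∈ C

/-- A group is polycyclic if it has a finite subnormal chain `⊥ = G₀ ≤ ⋯ ≤ Gₙ = ⊤`
with each `Gᵢ` normal in `Gᵢ₊₁` and each quotient `Gᵢ₊₁/Gᵢ` cyclic. -/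
def IsPolycyclic (G : Type*) [Group G] : Prop :=
  ∃ (n : ℕ) (s : Fin (n + 1) → Subgroup G),
    s 0 = ⊥ ∧ s (Fin.last n) = ⊤ ∧
    ∀ i : Fin n,
      s i.castSucc ≤ s i.succ ∧
      ∃ hn : ((s i.castSucc).subgroupOf (s i.succ)).Normal,
        letI := hn
        IsCyclic ((s i.succ) ⧸ (s i.castSucc).subgroupOf (s i.succ))

section Shift

variable {G : Type*} [Group G] {A : Type*}

lemma shift_shift (g h : G) (x : G → A) : shift g (shift h x) = shift (g * h) x := by
  ext; simp [shift, mul_assoc]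

lemma shift_one (x : G → A) : shift 1 x = x := by
  ext; simp [shift]

end Shift

section LocalConstraints

open Set

variable {G : Type*} {A : Type*}

lemma isClosed_eqOn [TopologicalSpace A] [T2Space A] {Z : Type*} [TopologicalSpace Z]
    {f g : Z → G → A} (hf : Continuous f) (hg : Continuous g) (S : Set G) : IsClosed {z | EqOn (f z) (g z) S} := by
  have : {z | EqOn (f z) (g z) S} = ⋂ s ∈ S, {z | f z s = g z s} := by
    ext; simp [EqOn]
  rw [this]
  exact isClosed_biInter fun s _ => isClosed_eq (by fun_prop) (by fun_prop)

variable [Group A]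

/-- The configurations which agree on `S` with some element of `X`. -/
def agreeOn (X : Subgroup (G → A)) (S : Set G) : Subgroup (G → A) where
  carrier := {x | ∃ y ∈ X, EqOn y x S}
  one_mem' := ⟨1, X.one_mem, fun _ _ => rfl⟩
  mul_mem' := by
    rintro x x' ⟨y, hy, hyx⟩ ⟨y', hy', hyx'⟩
    exact ⟨y * y', X.mul_mem hy hy', fun s hs => by simp [hyx hs, hyx' hs]⟩
  inv_mem' := by
    rintro x ⟨y, hy, hyx⟩
    exact ⟨y⁻¹, X.inv_mem hy, fun s hs => by simp [hyx hs]⟩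

/-- The configurations which are trivial on `S`. -/
def trivialOn (A : Type*) [Group A] (S : Set G) : Subgroup (G → A) :=
  Subgroup.pi S fun _ => ⊥

lemma mem_trivialOn {S : Set G} {x : G → A} : x ∈ trivialOn A S ↔ ∀ s ∈ S, x s = 1 := by
  simp [trivialOn, Subgroup.mem_pi]

lemma mem_agreeOn {X : Subgroup (G → A)} {S : Set G} {x : G → A} :
    x ∈ agreeOn X S ↔ ∃ y ∈ X, EqOn y x S := Iff.rfl

lemma agreeOn_anti (X : Subgroup (G → A)) {S T : Set G} (h : S ⊆ T) :
    agreeOn X T ≤ agreeOn X S := fun _ ⟨y, hy, hyx⟩ => ⟨y, hy, hyx.mono h⟩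

lemma agreeOn_mono {X Y : Subgroup (G → A)} (hXY : X ≤ Y) (S : Set G) :
    agreeOn X S ≤ agreeOn Y S := fun _ ⟨y, hy, hyx⟩ => ⟨y, hXY hy, hyx⟩

lemma le_agreeOn (X : Subgroup (G → A)) (S : Set G) : X ≤ agreeOn X S :=
  fun x hx => ⟨x, hx, fun _ _ => rfl⟩

lemma trivialOn_le_agreeOn (X : Subgroup (G → A)) (S : Set G) :
    trivialOn A S ≤ agreeOn X S := fun _ hx =>
  ⟨1, X.one_mem, fun s hs => (mem_trivialOn.1 hx s hs).symm⟩

lemma trivialOn_anti {S T : Set G} (h : S ⊆ T) : trivialOn A T ≤ trivialOn A S :=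
  fun _ hx => mem_trivialOn.2 fun s hs => mem_trivialOn.1 hx s (h hs)

lemma agreeOn_eq_self {X : Subgroup (G → A)} {S : Set G} (hX : trivialOn A S ≤ X) :
    agreeOn X S = X := by
  refine le_antisymm ?_ (le_agreeOn X S)
  rintro x ⟨y, hy, hyx⟩
  have : y⁻¹ * x ∈ X := hX (mem_trivialOn.2 fun s hs => by simp [hyx hs])
  simpa using X.mul_mem hy this

variable [TopologicalSpace A] [DiscreteTopology A]

lemma isClosed_trivialOn (S : Set G) : IsClosed (trivialOn A S : Set (G → A)) := by
  convert isClosed_eqOn continuous_id (continuous_const (y := (1 : G → A))) S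
  ext
  simp [mem_trivialOn, EqOn]

variable [Finite A]

lemma isClosed_agreeOn {X : Subgroup (G → A)} (hX : IsClosed (X : Set (G → A))) (S : Set G) :
    IsClosed (agreeOn X S : Set (G → A)) := by
  have h : IsClosed {p : (G → A) × (G → A) | p.1 ∈ X ∧ EqOn p.1 p.2 S} := by
    refine (hX.preimage continuous_fst).inter ?_
    exact isClosed_eqOn continuous_fst continuous_snd S
  convert isClosedMap_snd_of_compactSpace _ h
  ext x
  simp [mem_agreeOn]

lemma mem_agreeOn_iUnion {X : Subgroup (G → A)} (hX : IsClosed (X : Set (G → A)))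
    {ι : Type*} [Nonempty ι] {S : ι → Set G} (hS : Directed (· ⊆ ·) S) {x : G → A}
    (hx : ∀ i, x ∈ agreeOn X (S i)) : x ∈ agreeOn X (⋃ i, S i) := by
  have hcl (i : ι) : IsClosed {y | y ∈ X ∧ EqOn y x (S i)} := by
    exact hX.inter (isClosed_eqOn continuous_id continuous_const (S i))
  obtain ⟨y, hy⟩ := IsCompact.nonempty_iInter_of_directed_nonempty_isCompact_isClosed
    (fun i => {y | y ∈ X ∧ EqOn y x (S i)})
    (fun i j => by
      obtain ⟨k, hik, hjk⟩ := hS i j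
      exact ⟨k, fun y hy => ⟨hy.1, hy.2.mono hik⟩, fun y hy => ⟨hy.1, hy.2.mono hjk⟩⟩)
    (fun i => hx i) (fun i => (hcl i).isCompact) hcl
  rw [mem_iInter] at hy
  refine ⟨y, (hy (Classical.arbitrary ι)).1, fun s hs => ?_⟩
  obtain ⟨i, hi⟩ := mem_iUnion.1 hs
  exact (hy i).2 hi

end LocalConstraints

section ShiftInvariant

open Set

variable {G : Type*} [Group G] {A : Type*} [Group A]

/-- Invariance of a set of configurations under the shifts by elements of `H`. -/
def ShiftInvariant (H : Subgroup G) (X : Subgroup (G → A)) : Prop :=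
  ∀ h ∈ H, ∀ x ∈ X, shift h x ∈ X

lemma ShiftInvariant.mono {H K : Subgroup G} (hHK : H ≤ K) {X : Subgroup (G → A)}
    (hX : ShiftInvariant K X) : ShiftInvariant H X := fun h hh => hX h (hHK hh)

lemma ShiftInvariant.inf {H : Subgroup G} {X Y : Subgroup (G → A)}
    (hX : ShiftInvariant H X) (hY : ShiftInvariant H Y) : ShiftInvariant H (X ⊓ Y) :=
  fun h hh x hx => ⟨hX h hh x hx.1, hY h hh x hx.2⟩

lemma shiftInvariant_trivialOn {H : Subgroup G} {S : Set G} (hS : ∀ h ∈ H, ∀ s ∈ S, h * s ∈ S) :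
    ShiftInvariant H (trivialOn A S) := fun _ hh _ hx =>
  mem_trivialOn.2 fun s hs => mem_trivialOn.1 hx _ (hS _ (H.inv_mem hh) s hs)

lemma ShiftInvariant.agreeOn {H : Subgroup G} {X : Subgroup (G → A)} (hX : ShiftInvariant H X)
    {S : Set G} (hS : ∀ h ∈ H, ∀ s ∈ S, h * s ∈ S) : ShiftInvariant H (agreeOn X S) := by
  rintro h hh x ⟨y, hy, hyx⟩
  exact ⟨shift h y, hX h hh y hy, fun s hs => hyx (hS _ (H.inv_mem hh) s hs)⟩

lemma mem_agreeOn_of_shift_mem {K : Subgroup G} {X : Subgroup (G → A)} (hX : ShiftInvariant K X)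
    {k : G} (hk : k ∈ K) {S T : Set G} (hST : ∀ s ∈ S, k * s ∈ T) {x : G → A}
    (hx : shift k x ∈ agreeOn X T) : x ∈ agreeOn X S := by
  obtain ⟨y, hy, hyx⟩ := hx
  refine ⟨shift k⁻¹ y, hX _ (K.inv_mem hk) y hy, fun s hs => ?_⟩
  simpa [shift] using hyx (hST s hs)

end ShiftInvariant

section FiniteTypeOver

open Set

variable {G : Type*} [Group G]

/-- Every closed `H`-invariant subgroup of `G → A` that only constrains finitely many right cosets
of `H` is of finite type with respect to the shifts by elements of `H`. -/
def FiniteTypeOver (A : Type*) [Group A] [TopologicalSpace A] (H : Subgroup G) : Prop :=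
  ∀ X : Subgroup (G → A), IsClosed (X : Set (G → A)) → ShiftInvariant H X →
    (∃ F : Set G, F.Finite ∧ trivialOn A (image2 (· * ·) H F) ≤ X) →
    ∃ C : Set (G → A), IsClopen C ∧ ∀ x, x ∈ X ↔ ∀ h ∈ H, shift h x ∈ C

variable {A : Type*} [Group A] [TopologicalSpace A]

lemma finiteTypeOver_bot [DiscreteTopology A] : FiniteTypeOver A (⊥ : Subgroup G) := by
  rintro X hX - ⟨F, hF, hFX⟩
  have hnhds : (X : Set (G → A)) ∈ nhds 1 := by
    have h : (F.pi fun _ => {1} : Set (G → A)) ∈ nhds 1 :=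
      set_pi_mem_nhds hF fun _ _ => by simp
    exact Filter.mem_of_superset h fun x hx => hFX (mem_trivialOn.2 (by simpa using hx))
  exact ⟨X, ⟨hX, X.isOpen_of_mem_nhds hnhds⟩, fun x => by simp [shift_one]⟩

lemma FiniteTypeOver.of_finiteIndex {H : Subgroup G} [H.FiniteIndex] (hH : FiniteTypeOver A H)
    {X : Subgroup (G → A)} (hX : IsClosed (X : Set (G → A))) (hXG : ShiftInvariant ⊤ X) :
    ∃ C : Set (G → A), IsClopen C ∧ ∀ x, x ∈ X ↔ ∀ g : G, shift g x ∈ C := by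
  obtain ⟨F, hF⟩ : ∃ F : Set G, F.Finite ∧ ∀ g : G, ∃ h ∈ H, ∃ f ∈ F, h * f = g := by
    refine ⟨range fun q : G ⧸ H => q.out⁻¹, finite_range _, fun g => ?_⟩
    obtain ⟨h, hh⟩ := QuotientGroup.mk_out_eq_mul H g⁻¹
    exact ⟨h, h.2, _, mem_range_self (QuotientGroup.mk g⁻¹), by simp [hh]⟩
  obtain ⟨C, hC, hXC⟩ := hH X hX (hXG.mono le_top) ⟨F, hF.1, fun x hx => by
    have : x = 1 := funext fun g => mem_trivialOn.1 hx g (hF.2 g)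
    exact this ▸ X.one_mem⟩
  refine ⟨C, hC, fun x => ⟨fun hx g => ?_, fun hx => (hXC x).2 fun h _ => hx h⟩⟩
  simpa [shift_one] using (hXC _).1 (hXG g trivial x hx) 1 H.one_mem

variable [Finite A]

lemma FiniteTypeOver.exists_forall_le {H : Subgroup G} (hH : FiniteTypeOver A H)
    {Y : ℕ → Subgroup (G → A)} (hY : Antitone Y) (hcl : ∀ n, IsClosed (Y n : Set (G → A)))
    (hinv : ∀ n, ShiftInvariant H (Y n)) {F : Set G} (hF : F.Finite)
    (hFY : ∀ n, trivialOn A (image2 (· * ·) H F) ≤ Y n) : ∃ N, ∀ n, Y N ≤ Y n := by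
  obtain ⟨C, hC, hYC⟩ := hH (⨅ n, Y n)
    (by rw [Subgroup.coe_iInf]; exact isClosed_iInter hcl)
    (fun h hh x hx => by
      rw [Subgroup.mem_iInf] at hx ⊢
      exact fun n => hinv n h hh x (hx n))
    ⟨F, hF, le_iInf hFY⟩
  obtain ⟨N, hN⟩ := exists_subset_nhds_of_compactSpace
    (V := fun n => (Y n : Set (G → A))) hY.directed_ge hcl (U := C) (fun x hx => by
      refine hC.isOpen.mem_nhds ?_
      have := (hYC x).1 (by simpa [Subgroup.mem_iInf] using hx) 1 H.one_mem
      rwa [shift_one] at this)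
  refine ⟨N, fun n x hx => ?_⟩
  have : x ∈ ⨅ n, Y n := (hYC x).2 fun h hh => hN (hinv N h hh x hx)
  exact Subgroup.mem_iInf.1 this n

lemma mem_sup_zpowers {H : Subgroup G} {t : G} (ht : t ∈ Subgroup.normalizer (H : Set G)) {g : G}
    (hg : g ∈ H ⊔ Subgroup.zpowers t) : ∃ h ∈ H, ∃ n : ℤ, g = h * t ^ n := by
  rw [← SetLike.mem_coe, Subgroup.coe_mul_of_right_le_normalizer_left _ _
    (by simpa [Subgroup.zpowers_le] using ht)] at hg
  obtain ⟨h, hh, _, ⟨n, rfl⟩, rfl⟩ := hg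
  exact ⟨h, hh, n, rfl⟩

end FiniteTypeOver

section CyclicExtension

open Set

variable {G : Type*} [Group G]

/-- `K` is generated by `H` and one element normalizing `H`; equivalently, `H` is normal in `K` with
cyclic quotient. -/
def CyclicExtension (H K : Subgroup G) : Prop :=
  ∃ t ∈ Subgroup.normalizer (H : Set G), K = H ⊔ Subgroup.zpowers t

/-- The union of the translates `t ^ j * R` for `a ≤ j ≤ b`. -/
def zpowTranslates (t : G) (R : Set G) (a b : ℤ) : Set G :=
  {g | ∃ j ∈ Icc a b, ∃ r ∈ R, t ^ j * r = g}

lemma zpowTranslates_mono (t : G) (R : Set G) {a b a' b' : ℤ} (ha : a' ≤ a) (hb : b ≤ b') :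
    zpowTranslates t R a b ⊆ zpowTranslates t R a' b' := by
  rintro _ ⟨j, hj, r, hr, rfl⟩
  exact ⟨j, Icc_subset_Icc ha hb hj, r, hr, rfl⟩

lemma zpow_mul_mem_zpowTranslates {t : G} {R : Set G} {a b c d : ℤ} (k : ℤ) (hc : c = k + a)
    (hd : d = k + b) {g : G} (hg : g ∈ zpowTranslates t R a b) :
    t ^ k * g ∈ zpowTranslates t R c d := by
  obtain ⟨j, hj, r, hr, rfl⟩ := hg
  refine ⟨k + j, ?_, r, hr, by rw [zpow_add, mul_assoc]⟩
  simp only [mem_Icc] at hj ⊢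
  lia

lemma mul_mem_zpowTranslates {H : Subgroup G} {t : G} (ht : t ∈ Subgroup.normalizer (H : Set G))
    {F : Set G} {a b : ℤ} {h : G} (hh : h ∈ H) {g : G}
    (hg : g ∈ zpowTranslates t (image2 (· * ·) (H : Set G) F) a b) :
    h * g ∈ zpowTranslates t (image2 (· * ·) (H : Set G) F) a b := by
  obtain ⟨j, hj, _, ⟨k, hk, f, hf, rfl⟩, rfl⟩ := hg
  have := (Subgroup.mem_normalizer_iff''.1 (zpow_mem ht j) h).1 hh
  exact ⟨j, hj, _, ⟨_, H.mul_mem this hk, f, hf, rfl⟩, by simp only; group⟩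

lemma zpowTranslates_eq {H : Subgroup G} {t : G} (ht : t ∈ Subgroup.normalizer (H : Set G))
    (F : Set G) (a b : ℤ) :
    zpowTranslates t (image2 (· * ·) (H : Set G) F) a b =
      image2 (· * ·) (H : Set G) (image2 (fun j f => t ^ j * f) (Icc a b) F) := by
  ext g
  constructor
  · rintro ⟨j, hj, _, ⟨h, hh, f, hf, rfl⟩, rfl⟩
    exact ⟨t ^ j * h * (t ^ j)⁻¹, (Subgroup.mem_normalizer_iff.1 (zpow_mem ht j) h).1 hh, _,
      ⟨j, hj, f, hf, rfl⟩, by simp only; group⟩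
  · rintro ⟨h, hh, _, ⟨j, hj, f, hf, rfl⟩, rfl⟩
    exact mul_mem_zpowTranslates ht hh ⟨j, hj, f, ⟨1, H.one_mem, f, hf, by simp⟩, rfl⟩

variable {A : Type*} [Group A]

/-- If `X` is invariant under `t` and the values on `R` of the elements of `X` trivial on the `n`
preceding translates of `R` do not depend on `n ≥ N`, then configurations locally in `X` on windows
of `N + 1` translates are in `X` on all finite windows. -/
lemma mem_agreeOn_zpowTranslates {X : Subgroup (G → A)} {K : Subgroup G}
    (hX : ShiftInvariant K X) {t : G} (ht : t ∈ K) {R : Set G} {N : ℕ}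
    (hN : ∀ n : ℕ,
      agreeOn (X ⊓ trivialOn A (zpowTranslates t R (-N) (-1))) (zpowTranslates t R 0 0) ≤
      agreeOn (X ⊓ trivialOn A (zpowTranslates t R (-n) (-1))) (zpowTranslates t R 0 0))
    {x : G → A} (hx : ∀ k : ℤ, shift (t ^ k) x ∈ agreeOn X (zpowTranslates t R (-N) 0))
    (n : ℕ) (hn : N ≤ n) (j : ℤ) : x ∈ agreeOn X (zpowTranslates t R (j - n) j) := by
  induction n, hn using Nat.le_induction generalizing j with
  | base =>
    exact mem_agreeOn_of_shift_mem hX (zpow_mem ht (-j))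
      (fun g hg => zpow_mul_mem_zpowTranslates (-j) (by lia) (by lia) hg) (hx (-j))
  | succ n hn ih =>
    obtain ⟨y, hy, hyx⟩ := ih (j - 1)
    obtain ⟨z, hz, hzx⟩ := ih j
    have hu : shift (t ^ (-j)) (z⁻¹ * y) ∈
        agreeOn (X ⊓ trivialOn A (zpowTranslates t R (-n) (-1))) (zpowTranslates t R 0 0) := by
      refine le_agreeOn _ _ ⟨hX _ (zpow_mem ht _) _ (X.mul_mem (X.inv_mem hz) hy),
        mem_trivialOn.2 fun g hg => ?_⟩
      have hg' : t ^ j * g ∈ zpowTranslates t R (j - n) (j - 1) :=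
        zpow_mul_mem_zpowTranslates j (by lia) (by lia) hg
      have h₁ := hyx (zpowTranslates_mono t R (by lia) le_rfl hg')
      have h₂ := hzx (zpowTranslates_mono t R le_rfl (by lia) hg')
      simp [shift, h₁, h₂]
    have hanti : trivialOn A (zpowTranslates t R (-n) (-1)) ≤
        trivialOn A (zpowTranslates t R (-N) (-1)) :=
      trivialOn_anti (zpowTranslates_mono t R (by lia) le_rfl)
    obtain ⟨w, ⟨hwX, hw⟩, hwu⟩ :=
      hN (n + 1) (agreeOn_mono (inf_le_inf_left X hanti) _ hu)
    refine ⟨y * (shift (t ^ j) w)⁻¹, X.mul_mem hy (X.inv_mem (hX _ (zpow_mem ht _) _ hwX)), ?_⟩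
    rintro _ ⟨i, hi, r, hr, rfl⟩
    have key (i : ℤ) : (t ^ j)⁻¹ * (t ^ i * r) = t ^ (i - j) * r := by group
    simp only [mem_Icc] at hi
    simp only [Pi.mul_apply, Pi.inv_apply, shift, key]
    rcases hi.2.lt_or_eq with hij | rfl
    · rw [mem_trivialOn.1 hw _ ⟨i - j, by simp only [mem_Icc]; lia, r, hr, rfl⟩,
        hyx ⟨i, by simp only [mem_Icc]; lia, r, hr, rfl⟩]
      simp
    · rw [hwu ⟨i - i, by simp, r, hr, rfl⟩, ← hzx ⟨i, by simp, r, hr, rfl⟩]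
      simp [shift]

variable [TopologicalSpace A] [DiscreteTopology A] [Finite A]

lemma FiniteTypeOver.of_cyclicExtension {H K : Subgroup G} (hH : FiniteTypeOver A H)
    (hHK : CyclicExtension H K) : FiniteTypeOver A K := by
  obtain ⟨t, ht, rfl⟩ := hHK
  rintro X hX hinv ⟨F, hF, hFX⟩
  have htK : t ∈ H ⊔ Subgroup.zpowers t :=
    Subgroup.mem_sup_right (Subgroup.mem_zpowers t)
  have hinvH : ShiftInvariant H X := hinv.mono le_sup_left
  set R : Set G := image2 (· * ·) (H : Set G) F with hR
  have hRH (a b : ℤ) (h : G) (hh : h ∈ H) (g : G) (hg : g ∈ zpowTranslates t R a b) :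
      h * g ∈ zpowTranslates t R a b := mul_mem_zpowTranslates ht hh hg
  have hfin (a b : ℤ) : (image2 (fun (j : ℤ) f => t ^ j * f) (Icc a b) F).Finite :=
    (finite_Icc a b).image2 _ hF
  obtain ⟨N, hN⟩ := hH.exists_forall_le
    (Y := fun n : ℕ => agreeOn (X ⊓ trivialOn A (zpowTranslates t R (-n) (-1)))
      (zpowTranslates t R 0 0))
    (fun m n hmn => agreeOn_mono (inf_le_inf_left X
      (trivialOn_anti (zpowTranslates_mono t R (by lia) le_rfl))) _)
    (fun n => isClosed_agreeOn (hX.inter (isClosed_trivialOn _)) _)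
    (fun n => (hinvH.inf (shiftInvariant_trivialOn (hRH _ _))).agreeOn (hRH _ _))
    (hfin 0 0)
    (fun n => by rw [← zpowTranslates_eq ht]; exact trivialOn_le_agreeOn _ _)
  obtain ⟨C, hC, hXC⟩ := hH (agreeOn X (zpowTranslates t R (-N) 0)) (isClosed_agreeOn hX _)
    (hinvH.agreeOn (hRH _ _))
    ⟨_, hfin (-N) 0, by rw [← zpowTranslates_eq ht]; exact trivialOn_le_agreeOn _ _⟩
  refine ⟨C, hC, fun x => ⟨fun hx k hk => ?_, fun hx => ?_⟩⟩
  · have := (hXC _).1 (le_agreeOn _ _ (hinv k hk x hx)) 1 H.one_mem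
    rwa [shift_one] at this
  · have hloc (k : ℤ) : shift (t ^ k) x ∈ agreeOn X (zpowTranslates t R (-N) 0) :=
      (hXC _).2 fun h hh => by
        rw [shift_shift]
        exact hx _ (mul_mem (Subgroup.mem_sup_left hh) (zpow_mem htK k))
    have hfinite (i : ℕ) : x ∈ agreeOn X (zpowTranslates t R (-i) i) :=
      agreeOn_anti X (zpowTranslates_mono t R (by push_cast; lia) le_rfl)
        (mem_agreeOn_zpowTranslates hinv htK hN hloc (2 * i + N) (by lia) i)
    have hdir : Directed (· ⊆ ·) fun i : ℕ => zpowTranslates t R (-i) i :=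
      directed_of_isDirected_le fun i j hij => zpowTranslates_mono t R (by lia) (by lia)
    have hx' := mem_agreeOn_iUnion hX hdir hfinite
    rwa [agreeOn_eq_self] at hx'
    refine le_trans (trivialOn_anti ?_) hFX
    rintro _ ⟨k, hk, f, hf, rfl⟩
    obtain ⟨h, hh, n, rfl⟩ := mem_sup_zpowers ht hk
    refine mem_iUnion.2 ⟨n.natAbs, ?_⟩
    rw [hR, zpowTranslates_eq ht]
    exact ⟨h, hh, _, ⟨n, by simp only [mem_Icc]; lia, f, hf, rfl⟩, by simp [mul_assoc]⟩

end CyclicExtension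

section MaximalCondition

open Set

lemma Subgroup.fg_of_fg_map {G G' : Type*} [Group G] [Group G'] {f : G →* G'}
    (hf : Function.Injective f) (H : Subgroup G) (h : (H.map f).FG) : H.FG := by
  rw [Subgroup.fg_iff_submonoid_fg] at h ⊢
  exact h.map_injective f hf

lemma Subgroup.fg_of_forall_isSFT {G : Type*} [Group G] {A : Type*} [Group A] [Finite A]
    [Nontrivial A] [TopologicalSpace A] [DiscreteTopology A]
    (hG : ∀ X : Subgroup (G → A), IsClosed (X : Set (G → A)) → ShiftInvariant ⊤ X →
      ∃ C : Set (G → A), IsClopen C ∧ ∀ x, x ∈ X ↔ ∀ g : G, shift g x ∈ C)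
    (H : Subgroup G) : H.FG := by
  classical
  let X : Subgroup (G → A) :=
    { carrier := {x | ∀ g, ∀ h ∈ H, x (g * h) = x g}
      one_mem' := fun _ _ _ => rfl
      mul_mem' := fun hx hy g h hh => by simp [hx g h hh, hy g h hh]
      inv_mem' := fun hx g h hh => by simp [hx g h hh] }
  have hX : IsClosed (X : Set (G → A)) := by
    have : (X : Set (G → A)) = ⋂ g, ⋂ h ∈ H, {x | x (g * h) = x g} := by
      ext; simp [X]
    rw [this]
    exact isClosed_iInter fun g => isClosed_biInter fun h _ =>
      isClosed_eq (continuous_apply _) (continuous_apply _)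
  have hXG : ShiftInvariant ⊤ X := fun k _ x hx g h hh => by
    simpa [shift, mul_assoc] using hx (k⁻¹ * g) h hh
  obtain ⟨C, hC, hXC⟩ := hG X hX hXG
  obtain ⟨F, hF⟩ : ∃ F : Finset G, (agreeOn X (F : Set G) : Set (G → A)) ⊆ C := by
    refine exists_subset_nhds_of_compactSpace
      (directed_of_isDirected_le fun F F' h => agreeOn_anti X (Finset.coe_subset.2 h))
      (fun F => isClosed_agreeOn hX _) fun x hx => hC.isOpen.mem_nhds ?_
    have hx' : x ∈ agreeOn X (⋃ F : Finset G, (F : Set G)) :=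
      mem_agreeOn_iUnion hX (directed_of_isDirected_le fun F F' h => Finset.coe_subset.2 h)
        (by simpa using hx)
    obtain ⟨y, hy, hyx⟩ := hx'
    obtain rfl : y = x := funext fun g => hyx (mem_iUnion.2 ⟨{g}, by simp⟩)
    simpa [shift_one] using (hXC y).1 hy 1
  let T : Set G := image2 (fun f f' => f⁻¹ * f') F F ∩ H
  have hT : T.Finite := (F.finite_toSet.image2 _ F.finite_toSet).inter_of_left _
  suffices H ≤ Subgroup.closure T from
    ⟨hT.toFinset, le_antisymm (by simp [Subgroup.closure_le, T]) (by simpa using this)⟩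
  intro h hh
  obtain ⟨a, ha⟩ := exists_ne (1 : A)
  let x : G → A := fun g => if g ∈ Subgroup.closure T then a else 1
  have hx : x ∈ X := (hXC x).2 fun g => hF <| by
    by_cases hg : ∃ f ∈ F, g⁻¹ * f ∈ Subgroup.closure T
    · obtain ⟨f, hfF, hf⟩ := hg
      refine ⟨shift g fun k => if k ∈ H then a else 1, hXG g trivial _ fun k h hh => ?_,
        fun f' hf' => ?_⟩
      · simp [H.mul_mem_cancel_right hh]
      · have hTH : Subgroup.closure T ≤ H := (Subgroup.closure_le H).2 inter_subset_right
        have hfH := hTH hf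
        have hiff : g⁻¹ * f' ∈ H ↔ g⁻¹ * f' ∈ Subgroup.closure T := by
          refine ⟨fun hf'H => ?_, fun h => hTH h⟩
          have hmem : f⁻¹ * f' ∈ Subgroup.closure T :=
            Subgroup.subset_closure ⟨⟨f, hfF, f', hf', rfl⟩, by
              simpa [mul_assoc] using H.mul_mem (H.inv_mem hfH) hf'H⟩
          simpa [mul_assoc] using mul_mem hf hmem
        simp [shift, x, hiff]
    · push Not at hg
      exact ⟨1, X.one_mem, fun f hf => by simp [shift, x, hg f hf]⟩
  by_contra hhT
  have := hx 1 h hh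
  simp [x, hhT, ha.symm] at this

/-- The permutations with finite support. -/
def finitaryPerm (α : Type*) : Subgroup (Equiv.Perm α) where
  carrier := {σ | {a | σ a ≠ a}.Finite}
  one_mem' := by simp
  mul_mem' := fun {σ τ} hσ hτ => (hσ.union hτ).subset fun a ha => by
    by_contra h
    simp_all
  inv_mem' := fun {σ} hσ => hσ.subset fun a ha h => ha (by rw [Equiv.Perm.inv_eq_iff_eq, h])

lemma FreeGroup.exists_subgroup_not_fg : ∃ L : Subgroup (FreeGroup (Fin 2)), ¬ L.FG := by
  let φ : FreeGroup (Fin 2) →* Equiv.Perm ℤ :=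
    FreeGroup.lift ![Equiv.addRight 1, Equiv.swap 0 1]
  refine ⟨(finitaryPerm ℤ).comap φ, ?_⟩
  rintro ⟨T, hT⟩
  let U : Set ℤ := ⋃ τ ∈ T, {m | φ τ m ≠ m}
  have hU : U.Finite := T.finite_toSet.biUnion fun τ hτ => by
    have : τ ∈ (finitaryPerm ℤ).comap φ := hT ▸ Subgroup.subset_closure hτ
    exact this
  have hfix : (finitaryPerm ℤ).comap φ ≤ (fixingSubgroup (Equiv.Perm ℤ) Uᶜ).comap φ := by
    rw [← hT, Subgroup.closure_le]
    intro τ hτ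
    refine (mem_fixingSubgroup_iff _).2 fun m hm => ?_
    by_contra h
    exact hm (mem_biUnion hτ h)
  obtain ⟨n, hn⟩ := hU.exists_notMem
  let w : FreeGroup (Fin 2) := .of 0 ^ n * .of 1 * (.of 0 ^ n)⁻¹
  have hw (m : ℤ) : φ w m = Equiv.swap 0 1 (m - n) + n := by
    simp [w, φ, sub_eq_add_neg]
  have hwL : w ∈ (finitaryPerm ℤ).comap φ := by
    refine (Set.toFinite {n, n + 1}).subset fun m hm => ?_
    by_contra h
    simp only [mem_insert_iff, mem_singleton_iff, not_or] at h
    refine hm ?_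
    rw [hw, Equiv.swap_apply_of_ne_of_ne (by lia) (by lia)]
    lia
  have := (mem_fixingSubgroup_iff _).1 (hfix hwL) n hn
  simp [hw] at this

end MaximalCondition

section Polycyclic

open Set Relation

variable {G : Type*} [Group G]

lemma cyclicExtension_iff {H K : Subgroup G} :
    CyclicExtension H K ↔ H ≤ K ∧ ∃ hn : (H.subgroupOf K).Normal,
      letI := hn
      IsCyclic (K ⧸ H.subgroupOf K) := by
  constructor
  · rintro ⟨t, ht, rfl⟩
    have hnorm : (H.subgroupOf (H ⊔ Subgroup.zpowers t)).Normal :=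
      (Subgroup.normal_subgroupOf_iff_le_normalizer le_sup_left).2
        (sup_le Subgroup.le_normalizer (by simpa [Subgroup.zpowers_le] using ht))
    refine ⟨le_sup_left, hnorm, ⟨⟨QuotientGroup.mk ⟨t, Subgroup.mem_sup_right
      (Subgroup.mem_zpowers t)⟩, fun q => ?_⟩⟩⟩
    obtain ⟨⟨g, hg⟩, rfl⟩ := QuotientGroup.mk_surjective q
    obtain ⟨h, hh, n, rfl⟩ := mem_sup_zpowers ht hg
    refine ⟨n, ?_⟩
    simp only
    rw [← QuotientGroup.mk_zpow, eq_comm, QuotientGroup.eq_iff_div_mem, Subgroup.mem_subgroupOf]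
    simpa using hh
  · rintro ⟨hHK, hn, ⟨⟨q, hq⟩⟩⟩
    obtain ⟨⟨t, htK⟩, rfl⟩ := QuotientGroup.mk_surjective q
    refine ⟨t, (Subgroup.normal_subgroupOf_iff_le_normalizer hHK).1 hn htK,
      le_antisymm (fun k hk => ?_) (sup_le hHK (by simpa [Subgroup.zpowers_le] using htK))⟩
    obtain ⟨n, hn'⟩ := hq (QuotientGroup.mk ⟨k, hk⟩)
    simp only at hn'
    rw [← QuotientGroup.mk_zpow, eq_comm, QuotientGroup.eq_iff_div_mem,
      Subgroup.mem_subgroupOf] at hn'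
    have hk' : k / t ^ n ∈ H := by simpa using hn'
    rw [← div_mul_cancel k (t ^ n)]
    exact Subgroup.mul_mem_sup hk' (Subgroup.zpow_mem_zpowers t n)

lemma CyclicExtension.map {G' : Type*} [Group G'] (f : G →* G') {H K : Subgroup G}
    (h : CyclicExtension H K) : CyclicExtension (H.map f) (K.map f) := by
  obtain ⟨t, ht, rfl⟩ := h
  exact ⟨f t, Subgroup.le_normalizer_map f (Subgroup.mem_map_of_mem f ht), by
    rw [Subgroup.map_sup, MonoidHom.map_zpowers]⟩

lemma FiniteTypeOver.of_reflTransGen {A : Type*} [Group A] [TopologicalSpace A]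
    [DiscreteTopology A] [Finite A] {H K : Subgroup G} (hH : FiniteTypeOver A H)
    (hHK : ReflTransGen CyclicExtension H K) : FiniteTypeOver A K := by
  induction hHK with
  | refl => exact hH
  | tail _ h ih => exact ih.of_cyclicExtension h

lemma isPolycyclic_iff_reflTransGen :
    IsPolycyclic G ↔ ReflTransGen CyclicExtension (⊥ : Subgroup G) ⊤ := by
  simp only [IsPolycyclic, ← cyclicExtension_iff]
  constructor
  · rintro ⟨n, s, h₀, hn, hs⟩
    rw [← h₀, ← hn]
    exact Fin.induction .refl (fun i ih => ih.tail (hs i)) (Fin.last n)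
  · generalize (⊤ : Subgroup G) = K
    intro h
    induction h with
    | refl => exact ⟨0, fun _ => ⊥, rfl, rfl, fun i => i.elim0⟩
    | @tail H K _ hHK ih =>
      obtain ⟨n, s, h₀, hn, hs⟩ := ih
      refine ⟨n + 1, Fin.snoc (α := fun _ => Subgroup G) s K, ?_, by simp, fun i => ?_⟩
      · rw [← Fin.castSucc_zero, Fin.snoc_castSucc, h₀]
      · induction i using Fin.lastCases with
        | last => simpa [Fin.succ_last, hn] using hHK
        | cast i => simpa only [← Fin.castSucc_succ, Fin.snoc_castSucc] using hs i

lemma reflTransGen_cyclicExtension_of_commutator_le {H K : Subgroup G} (hHK : H ≤ K)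
    (hcomm : ⁅K, K⁆ ≤ H) (hK : K.FG) : ReflTransGen CyclicExtension H K := by
  have hnorm {L : Subgroup G} (hHL : H ≤ L) (hLK : L ≤ K) : K ≤ Subgroup.normalizer (L : Set G) :=
    Subgroup.le_normalizer_iff.2 fun k hk l hl => by
      have := L.mul_mem (hHL (hcomm (Subgroup.commutator_mem_commutator hk (hLK hl)))) hl
      simpa [commutatorElement_def] using this
  have key (T : Set G) (hT : T.Finite) (hTK : T ⊆ K) :
      ReflTransGen CyclicExtension H (H ⊔ Subgroup.closure T) := by
    induction T, hT using Set.Finite.induction_on with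
    | empty => simpa using ReflTransGen.refl
    | @insert t T _ _ ih =>
      rw [insert_subset_iff] at hTK
      refine (ih hTK.2).tail ⟨t, hnorm le_sup_left
        (sup_le hHK ((Subgroup.closure_le K).2 hTK.2)) hTK.1, ?_⟩
      rw [insert_eq, union_comm, Subgroup.closure_union, sup_assoc, Subgroup.zpowers_eq_closure]
  obtain ⟨T, rfl⟩ := hK
  simpa [hHK] using key T T.finite_toSet Subgroup.subset_closure

lemma isPolycyclic_of_isSolvable [Group.IsSolvable G] (hG : ∀ H : Subgroup G, H.FG) :
    IsPolycyclic G := by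
  obtain ⟨n, hn⟩ := Group.IsSolvable.solvable (G := G)
  rw [isPolycyclic_iff_reflTransGen, ← hn]
  clear hn
  induction n with
  | zero => exact .refl
  | succ n ih =>
    exact .trans (reflTransGen_cyclicExtension_of_commutator_le
      (derivedSeries_antitone G n.le_succ) le_rfl (hG _)) ih

end Polycyclic

/-- For a countable group satisfying the Tits alternative, all group shifts are of
finite type iff the group is virtually polycyclic. -/
theorem stmt_17 {G : Type*} [Group G] [Countable G]
    (tits : ∀ H : Subgroup G, H.FG →
      (∃ φ : FreeGroup (Fin 2) →* ↥H, Function.Injective φ) ∨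
      (∃ K : Subgroup ↥H, K.FiniteIndex ∧ IsSolvable ↥K)) :
    (∀ (A : Type) [Group A] [Finite A] (X : Set (G → A)),
        @IsClosed _ (prodTop G A) X →
        (∀ (g : G) (x : G → A), x ∈ X → shift g x ∈ X) →
        (∃ S : Subgroup (G → A), ↑S = X) →
        IsSFT A X) ↔
      ∃ H : Subgroup G, H.FiniteIndex ∧ IsPolycyclic ↥H := by
  constructor
  · intro hsft
    have hfg : ∀ H : Subgroup G, H.FG := by
      let _ : TopologicalSpace (Multiplicative (ZMod 2)) := ⊥
      have : DiscreteTopology (Multiplicative (ZMod 2)) := ⟨rfl⟩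
      exact Subgroup.fg_of_forall_isSFT (A := Multiplicative (ZMod 2)) fun X hX hXG => by
        obtain ⟨C, hC⟩ := hsft _ X hX (fun g x hx => hXG g trivial x hx) ⟨X, rfl⟩
        exact ⟨C, hC⟩
    have hfg_sub (H : Subgroup G) (L : Subgroup H) : L.FG :=
      L.fg_of_fg_map H.subtype_injective (hfg _)
    rcases tits ⊤ (hfg ⊤) with ⟨φ, hφ⟩ | ⟨K, hK, hsolv⟩
    · obtain ⟨L, hL⟩ := FreeGroup.exists_subgroup_not_fg
      exact absurd (L.fg_of_fg_map hφ (hfg_sub _ _)) hL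
    · let e := K.equivMapOfInjective (⊤ : Subgroup G).subtype (Subgroup.subtype_injective _)
      have : Group.IsSolvable K := hsolv
      have : Group.IsSolvable (K.map (⊤ : Subgroup G).subtype) :=
        Group.isSolvable_of_surjective (f := e.toMonoidHom) e.surjective
      refine ⟨K.map (⊤ : Subgroup G).subtype, ⟨?_⟩, isPolycyclic_of_isSolvable (hfg_sub _)⟩
      rw [Subgroup.index_map_subtype]
      simpa using hK.index_ne_zero
  · rintro ⟨H, hH, hpoly⟩ A _ _ _ hX hXG ⟨X, rfl⟩
    let _ : TopologicalSpace A := ⊥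
    have : DiscreteTopology A := ⟨rfl⟩
    have hchain : Relation.ReflTransGen CyclicExtension ((⊥ : Subgroup H).map H.subtype)
        ((⊤ : Subgroup H).map H.subtype) :=
      (isPolycyclic_iff_reflTransGen.1 hpoly).lift (Subgroup.map H.subtype)
        fun _ _ h => h.map H.subtype
    rw [Subgroup.map_bot, ← MonoidHom.range_eq_map, H.range_subtype] at hchain
    exact (finiteTypeOver_bot.of_reflTransGen hchain).of_finiteIndex hX fun g _ => hXG g
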